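/- Let f : [0,T] × H → H be continuous and K-Lipschitz in its second variable, let 0 < ε ≤ 1, let (φ, g), (φᵉ, gᵉ) ∈ H × H with ‖φᵉ − φ‖ ≤ ε and ‖gᵉ − g‖ ≤ ε, let vᵉ be a continuous solution of the regularized integral equation with source f, parameter ε and data (φ,g), and let uᵉ be a continuous solution of the regularized integral equation with source f, parameter ε and data (φᵉ,gᵉ). Then for all t ∈ [0,T]: ‖uᵉ(t) − vᵉ(t)‖ ≤ √(3(1 + 1/λ₁))·exp(3TK²t/(2λ₁))·ε^{1−t/T}. -/

import Mathlib

open scoped RealInnerProductSpace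

/-- `Q(ε,λ) = e^{−√λ·T}/(ε + e^{−√λ·T})`. -/
noncomputable def regQ (T ε lam : ℝ) : ℝ :=
  Real.exp (-(Real.sqrt lam * T)) / (ε + Real.exp (-(Real.sqrt lam * T)))

/-- `coshᵉ(√λ·t) = (Q(ε,λ)e^{√λ·t} + e^{−√λ·t})/2`. -/
noncomputable def coshE (T ε lam t : ℝ) : ℝ :=
  (regQ T ε lam * Real.exp (Real.sqrt lam * t) + Real.exp (-(Real.sqrt lam * t))) / 2

/-- `sinhᵉ(√λ·t) = (Q(ε,λ)e^{√λ·t} − e^{−√λ·t})/2`. -/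
noncomputable def sinhE (T ε lam t : ℝ) : ℝ :=
  (regQ T ε lam * Real.exp (Real.sqrt lam * t) - Real.exp (-(Real.sqrt lam * t))) / 2

variable {H : Type*} [NormedAddCommGroup H] [InnerProductSpace ℝ H]

/-- `F` is `K`-Lipschitz in its second variable on `[0,T] × H`. -/
def LipschitzInSecond (T K : ℝ) (F : ℝ → H → H) : Prop :=
  ∀ t ∈ Set.Icc (0 : ℝ) T, ∀ w v : H, ‖F t w - F t v‖ ≤ K * ‖w - v‖

/-- `v` solves the regularized integral equation with source `F`, data `(φt, gt)`
and parameter `ε`. -/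
def SolvesReg (T ε : ℝ) (lam : ℕ → ℝ) (b : HilbertBasis ℕ ℝ H)
    (F : ℝ → H → H) (φt gt : H) (v : ℝ → H) : Prop :=
  ∀ t ∈ Set.Icc (0 : ℝ) T,
    v t = ∑' p : ℕ, (coshE T ε (lam p) t * ⟪φt, b p⟫
      + sinhE T ε (lam p) t / Real.sqrt (lam p) * ⟪gt, b p⟫
      + ∫ s in (0 : ℝ)..t,
          sinhE T ε (lam p) (t - s) / Real.sqrt (lam p) * ⟪F s (v s), b p⟫) • (b p : H)

/-- `u` solves the mild integral equation with source `F` and data `(φ, g)`. -/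
def SolvesMild (T : ℝ) (lam : ℕ → ℝ) (b : HilbertBasis ℕ ℝ H)
    (F : ℝ → H → H) (φ g : H) (u : ℝ → H) : Prop :=
  ∀ t ∈ Set.Icc (0 : ℝ) T,
    u t = ∑' p : ℕ, (Real.cosh (Real.sqrt (lam p) * t) * ⟪φ, b p⟫
      + Real.sinh (Real.sqrt (lam p) * t) / Real.sqrt (lam p) * ⟪g, b p⟫
      + ∫ s in (0 : ℝ)..t,
          Real.sinh (Real.sqrt (lam p) * (t - s)) / Real.sqrt (lam p)
            * ⟪F s (u s), b p⟫) • (b p : H)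

/-- The pair `(u, w)` satisfies the exponential coefficient identity with source `F`
and data `(φ, g)`. -/
def ExpCoeffId (T : ℝ) (lam : ℕ → ℝ) (b : HilbertBasis ℕ ℝ H)
    (F : ℝ → H → H) (φ g : H) (u w : ℝ → H) : Prop :=
  ∀ p : ℕ, ∀ t ∈ Set.Icc (0 : ℝ) T,
    ⟪u t, b p⟫ + ⟪w t, b p⟫ / Real.sqrt (lam p)
      = Real.exp (Real.sqrt (lam p) * t)
          * (⟪φ, b p⟫ + ⟪g, b p⟫ / Real.sqrt (lam p))
        + ∫ s in (0 : ℝ)..t,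
            Real.exp (Real.sqrt (lam p) * (t - s)) / Real.sqrt (lam p)
              * ⟪F s (u s), b p⟫

/-- The pair `(u, w)` satisfies the a priori bound with constant `P`. -/
def APrioriBound (T : ℝ) (lam : ℕ → ℝ) (b : HilbertBasis ℕ ℝ H)
    (u w : ℝ → H) (P : ℝ) : Prop :=
  ∀ t ∈ Set.Icc (0 : ℝ) T,
    ∑' p : ℕ, Real.exp (2 * Real.sqrt (lam p) * (T - t))
      * (⟪u t, b p⟫ + ⟪w t, b p⟫ / Real.sqrt (lam p)) ^ 2 ≤ P ^ 2

theorem aux_Q {T a ε lam t : ℝ} (hε : ε = Real.exp (-(a * T))) (ht : t ∈ Set.Icc 0 T) :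
    regQ T ε lam * Real.exp (Real.sqrt lam * t) ≤ Real.exp (a * t) := by
  unfold regQ
  subst hε
  set r := Real.sqrt lam
  have hr : 0 ≤ r := Real.sqrt_nonneg _
  obtain ⟨h0, h1⟩ := ht
  rw [div_mul_eq_mul_div, div_le_iff₀ (by positivity), ← Real.exp_add, mul_add, ← Real.exp_add,
    ← Real.exp_add]
  rcases le_total r a with h | h
  · have : Real.exp (-(r * T) + r * t) ≤ Real.exp (a * t + -(r * T)) := by
      apply Real.exp_le_exp.2; nlinarith
    have := Real.exp_pos (a * t + -(a * T))
    linarith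
  · have : Real.exp (-(r * T) + r * t) ≤ Real.exp (a * t + -(a * T)) := by
      apply Real.exp_le_exp.2; nlinarith
    have := Real.exp_pos (a * t + -(r * T))
    linarith

theorem aux_Q_nonneg {T ε lam t : ℝ} (hε : 0 < ε) :
    0 ≤ regQ T ε lam * Real.exp (Real.sqrt lam * t) := by
  unfold regQ; positivity

theorem aux_exp {a lam t : ℝ} (ha : 0 ≤ a) (ht : 0 ≤ t) :
    Real.exp (-(Real.sqrt lam * t)) ≤ Real.exp (a * t) := by
  apply Real.exp_le_exp.2
  have : 0 ≤ Real.sqrt lam * t := by positivity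
  have : 0 ≤ a * t := by positivity
  linarith

theorem aux_cosh_sq {T a ε lam t : ℝ} (ha : 0 ≤ a) (hε : ε = Real.exp (-(a * T)))
    (ht : t ∈ Set.Icc 0 T) : coshE T ε lam t ^ 2 ≤ Real.exp (a * t) ^ 2 := by
  have h1 := aux_Q (lam := lam) hε ht
  have h2 := aux_Q_nonneg (T := T) (lam := lam) (t := t) (hε ▸ Real.exp_pos _ : 0 < ε)
  have h3 := aux_exp (lam := lam) ha ht.1
  have h4 := Real.exp_pos (-(Real.sqrt lam * t))
  apply sq_le_sq'
  · unfold coshE; linarith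
  · unfold coshE; linarith

theorem aux_sinh_sq {T a ε lam t : ℝ} (ha : 0 ≤ a) (hε : ε = Real.exp (-(a * T)))
    (ht : t ∈ Set.Icc 0 T) : sinhE T ε lam t ^ 2 ≤ Real.exp (a * t) ^ 2 := by
  have h1 := aux_Q (lam := lam) hε ht
  have h2 := aux_Q_nonneg (T := T) (lam := lam) (t := t) (hε ▸ Real.exp_pos _ : 0 < ε)
  have h3 := aux_exp (lam := lam) ha ht.1
  have h4 := Real.exp_pos (-(Real.sqrt lam * t))
  apply sq_le_sq'
  · unfold sinhE; linarith
  · unfold sinhE; linarith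

theorem aux_sinh_div_sq {T a ε lam lam1 t : ℝ} (ha : 0 ≤ a) (hε : ε = Real.exp (-(a * T)))
    (h1 : 0 < lam1) (h2 : lam1 ≤ lam)
    (ht : t ∈ Set.Icc 0 T) :
    (sinhE T ε lam t / Real.sqrt lam) ^ 2 ≤ Real.exp (a * t) ^ 2 / lam1 := by
  rw [div_pow, Real.sq_sqrt (h1.le.trans h2)]
  exact div_le_div₀ (by positivity) (aux_sinh_sq ha hε ht) h1 h2

theorem aux_sinh_cont (T ε lam : ℝ) : Continuous (sinhE T ε lam) := by
  unfold sinhE; fun_prop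

theorem aux_cs {h : ℝ → ℝ} (hh : Continuous h) {t : ℝ} (ht : 0 ≤ t) :
    (∫ s in (0:ℝ)..t, h s) ^ 2 ≤ t * ∫ s in (0:ℝ)..t, h s ^ 2 := by
  rcases ht.eq_or_lt with rfl | ht
  · simp
  set I := ∫ s in (0:ℝ)..t, h s with hI
  have h0 : 0 ≤ ∫ s in (0:ℝ)..t, (t * h s - I) ^ 2 :=
    intervalIntegral.integral_nonneg ht.le (fun s _ => sq_nonneg _)
  have e : ∀ s, (t * h s - I) ^ 2 = t ^ 2 * h s ^ 2 - (2 * t * I) * h s + I ^ 2 := fun s => by ring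
  simp_rw [e] at h0
  rw [intervalIntegral.integral_add (Continuous.intervalIntegrable (by fun_prop) _ _)
      (Continuous.intervalIntegrable (by fun_prop) _ _),
    intervalIntegral.integral_sub (Continuous.intervalIntegrable (by fun_prop) _ _)
      (Continuous.intervalIntegrable (by fun_prop) _ _),
    intervalIntegral.integral_const_mul, intervalIntegral.integral_const_mul, ← hI] at h0
  simp only [intervalIntegral.integral_const, sub_zero, smul_eq_mul] at h0
  have : 0 ≤ t * (t * (∫ s in (0:ℝ)..t, h s ^ 2) - I ^ 2) := by nlinarith
  have := nonneg_of_mul_nonneg_right this ht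
  linarith

theorem aux_gronwall {y : ℝ → ℝ} (hy : Continuous y) {A B T : ℝ} (hB : 0 ≤ B) (hA : 0 ≤ A)
    (h0 : ∀ t, 0 ≤ y t)
    (h : ∀ t ∈ Set.Icc 0 T, y t ≤ A + B * ∫ s in (0:ℝ)..t, y s) :
    ∀ t ∈ Set.Icc 0 T, y t ≤ A * Real.exp (B * t) := by
  intro t ht
  have hd : ∀ x, HasDerivAt (fun t => A + B * ∫ s in (0:ℝ)..t, y s) (B * y x) x := fun x =>
    ((hy.integral_hasStrictDerivAt 0 x).hasDerivAt.const_mul B).const_add A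
  have hnn : ∀ x ∈ Set.Icc 0 T, 0 ≤ A + B * ∫ s in (0:ℝ)..x, y s := fun x hx =>
    add_nonneg hA (mul_nonneg hB (intervalIntegral.integral_nonneg hx.1 (fun s _ => h0 s)))
  have := norm_le_gronwallBound_of_norm_deriv_right_le (δ := A) (K := B) (ε := 0) (a := 0) (b := T)
    (f := fun t => A + B * ∫ s in (0:ℝ)..t, y s) (f' := fun x => B * y x)
    (fun x _ => (hd x).continuousAt.continuousWithinAt)
    (fun x _ => (hd x).hasDerivWithinAt) (by simp [abs_of_nonneg hA])
    (fun x hx => by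
      have hx' := Set.Ico_subset_Icc_self hx
      rw [Real.norm_of_nonneg (mul_nonneg hB (h0 x)), Real.norm_of_nonneg (hnn x hx'), add_zero]
      exact mul_le_mul_of_nonneg_left (h x hx') hB) t ht
  rw [gronwallBound_ε0, Real.norm_of_nonneg (hnn t ht), sub_zero] at this
  exact (h t ht).trans this

/-- coefficients -/
noncomputable def regCoef (T ε : ℝ) (lam : ℕ → ℝ) (b : HilbertBasis ℕ ℝ H)
    (φ g : H) (G : ℝ → H) (t : ℝ) (p : ℕ) : ℝ :=
  coshE T ε (lam p) t * ⟪φ, b p⟫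
      + sinhE T ε (lam p) t / Real.sqrt (lam p) * ⟪g, b p⟫
      + ∫ s in (0 : ℝ)..t,
          sinhE T ε (lam p) (t - s) / Real.sqrt (lam p) * ⟪G s, b p⟫

theorem aux_bessel (b : HilbertBasis ℕ ℝ H) (x : H) (S : Finset ℕ) :
    ∑ p ∈ S, ⟪x, b p⟫ ^ 2 ≤ ‖x‖ ^ 2 := by
  have := b.orthonormal.sum_inner_products_le x (s := S)
  simpa [real_inner_comm] using this

theorem regCoef_bound {T ε a lam1 : ℝ} {lam : ℕ → ℝ} (b : HilbertBasis ℕ ℝ H)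
    (ha : 0 ≤ a) (hε : ε = Real.exp (-(a * T)))
    (hlam1 : 0 < lam1) (hlam : ∀ p, lam1 ≤ lam p) (φ g : H) {G : ℝ → H} (hG : Continuous G)
    {t : ℝ} (ht : t ∈ Set.Icc 0 T) (S : Finset ℕ) :
    ∑ p ∈ S, regCoef T ε lam b φ g G t p ^ 2 ≤
      3 * Real.exp (a * t) ^ 2 * (‖φ‖ ^ 2 + ‖g‖ ^ 2 / lam1
        + T / lam1 * ∫ s in (0:ℝ)..t, (Real.exp (-(a * s)) * ‖G s‖) ^ 2) := by
  have hc := aux_sinh_cont T ε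
  have hT : 0 ≤ T := ht.1.trans ht.2
  have key : ∀ p, regCoef T ε lam b φ g G t p ^ 2 ≤
      3 * (Real.exp (a * t) ^ 2 * ⟪φ, b p⟫ ^ 2 + Real.exp (a * t) ^ 2 / lam1 * ⟪g, b p⟫ ^ 2
        + T * (Real.exp (a * t) ^ 2 / lam1) *
          ∫ s in (0:ℝ)..t, Real.exp (-(a * s)) ^ 2 * ⟪G s, b p⟫ ^ 2) := by
    intro p
    have h1 : (coshE T ε (lam p) t * ⟪φ, b p⟫) ^ 2 ≤ Real.exp (a * t) ^ 2 * ⟪φ, b p⟫ ^ 2 := by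
      rw [mul_pow]
      exact mul_le_mul_of_nonneg_right (aux_cosh_sq ha hε ht) (sq_nonneg _)
    have h2 : (sinhE T ε (lam p) t / Real.sqrt (lam p) * ⟪g, b p⟫) ^ 2 ≤
        Real.exp (a * t) ^ 2 / lam1 * ⟪g, b p⟫ ^ 2 := by
      rw [mul_pow]
      exact mul_le_mul_of_nonneg_right (aux_sinh_div_sq ha hε hlam1 (hlam p) ht) (sq_nonneg _)
    have h3 : (∫ s in (0 : ℝ)..t,
          sinhE T ε (lam p) (t - s) / Real.sqrt (lam p) * ⟪G s, b p⟫) ^ 2 ≤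
        T * (Real.exp (a * t) ^ 2 / lam1) *
          ∫ s in (0:ℝ)..t, Real.exp (-(a * s)) ^ 2 * ⟪G s, b p⟫ ^ 2 := by
      have hcp := hc (lam p)
      have hcont : Continuous fun s => sinhE T ε (lam p) (t - s) / Real.sqrt (lam p) * ⟪G s, b p⟫ :=
        by fun_prop
      refine (aux_cs hcont ht.1).trans ?_
      rw [mul_assoc]
      refine mul_le_mul ht.2 ?_ (intervalIntegral.integral_nonneg ht.1 (fun s _ => sq_nonneg _)) hT
      rw [← intervalIntegral.integral_const_mul]
      refine intervalIntegral.integral_mono_on ht.1 (Continuous.intervalIntegrable (by fun_prop) _ _)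
        (Continuous.intervalIntegrable (by fun_prop) _ _) ?_
      intro s hs
      rw [mul_pow, ← mul_assoc]
      refine mul_le_mul_of_nonneg_right ?_ (sq_nonneg _)
      refine (aux_sinh_div_sq ha hε hlam1 (hlam p) ⟨by linarith [hs.2], by linarith [hs.1, ht.2]⟩).trans
        (le_of_eq ?_)
      rw [div_mul_eq_mul_div, ← mul_pow, ← Real.exp_add]
      congr 3; ring
    unfold regCoef
    set x := coshE T ε (lam p) t * ⟪φ, b p⟫
    set y := sinhE T ε (lam p) t / Real.sqrt (lam p) * ⟪g, b p⟫
    set z := ∫ s in (0 : ℝ)..t, sinhE T ε (lam p) (t - s) / Real.sqrt (lam p) * ⟪G s, b p⟫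
    nlinarith [sq_nonneg (x - y), sq_nonneg (y - z), sq_nonneg (x - z)]
  refine (Finset.sum_le_sum fun p _ => key p).trans ?_
  rw [← Finset.mul_sum, Finset.sum_add_distrib, Finset.sum_add_distrib, ← Finset.mul_sum,
    ← Finset.mul_sum, ← Finset.mul_sum, ← intervalIntegral.integral_finsetSum
      (fun p _ => Continuous.intervalIntegrable (by fun_prop) _ _)]
  have i1 := aux_bessel b φ S
  have i2 := aux_bessel b g S
  have i3 : (∫ s in (0:ℝ)..t, ∑ p ∈ S, Real.exp (-(a * s)) ^ 2 * ⟪G s, b p⟫ ^ 2) ≤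
      ∫ s in (0:ℝ)..t, (Real.exp (-(a * s)) * ‖G s‖) ^ 2 := by
    refine intervalIntegral.integral_mono_on ht.1 (Continuous.intervalIntegrable (by fun_prop) _ _)
        (Continuous.intervalIntegrable (by fun_prop) _ _) ?_
    intro s hs
    rw [← Finset.mul_sum, mul_pow]
    exact mul_le_mul_of_nonneg_left (aux_bessel b _ S) (sq_nonneg _)
  calc _ ≤ 3 * (Real.exp (a * t) ^ 2 * ‖φ‖ ^ 2 + Real.exp (a * t) ^ 2 / lam1 * ‖g‖ ^ 2
        + T * (Real.exp (a * t) ^ 2 / lam1) *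
          ∫ s in (0:ℝ)..t, (Real.exp (-(a * s)) * ‖G s‖) ^ 2) := by gcongr
    _ = _ := by ring

theorem regCoef_sub {T ε : ℝ} {lam : ℕ → ℝ} (b : HilbertBasis ℕ ℝ H)
    (φ g φ' g' : H) {G G' : ℝ → H} (hG : Continuous G) (hG' : Continuous G') (t : ℝ) (p : ℕ) :
    regCoef T ε lam b φ g G t p - regCoef T ε lam b φ' g' G' t p =
      regCoef T ε lam b (φ - φ') (g - g') (fun s => G s - G' s) t p := by
  have hc := aux_sinh_cont T ε (lam p)
  unfold regCoef
  simp only [inner_sub_left, mul_sub]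
  rw [intervalIntegral.integral_sub (Continuous.intervalIntegrable (by fun_prop) _ _)
    (Continuous.intervalIntegrable (by fun_prop) _ _)]
  ring

theorem aux_summable [CompleteSpace H] (b : HilbertBasis ℕ ℝ H) {c : ℕ → ℝ} {M : ℝ}
    (h : ∀ S : Finset ℕ, ∑ p ∈ S, c p ^ 2 ≤ M) : Summable fun p => c p • b p := by
  have := (b.orthonormal.orthogonalFamily).summable_iff_norm_sq_summable (fun p => c p)
  simp only [LinearIsometry.toSpanSingleton_apply] at this
  rw [this]
  simp only [Real.norm_eq_abs, sq_abs]
  exact summable_of_sum_le (fun _ => sq_nonneg _) h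

theorem aux_norm [CompleteSpace H] (b : HilbertBasis ℕ ℝ H) {c : ℕ → ℝ} {M : ℝ}
    (h : ∀ S : Finset ℕ, ∑ p ∈ S, c p ^ 2 ≤ M) : ‖∑' p, c p • b p‖ ^ 2 ≤ M := by
  have hs := (aux_summable b h).hasSum
  refine le_of_tendsto ((hs.norm).pow 2) (Filter.Eventually.of_forall fun S => ?_)
  have : ‖∑ p ∈ S, c p • b p‖ ^ 2 = ∑ p ∈ S, c p ^ 2 := by
    rw [← real_inner_self_eq_norm_sq, b.orthonormal.inner_sum]
    simp [sq]
  rw [this]; exact h S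

theorem aux_main [CompleteSpace H] {T K ε a lam1 : ℝ} (hT : 0 < T) (ha : 0 ≤ a)
    (hε : ε = Real.exp (-(a * T)))
    (lam : ℕ → ℝ) (hlam1 : 0 < lam1) (hlam : ∀ p, lam1 ≤ lam p)
    (b : HilbertBasis ℕ ℝ H) (f : ℝ → H → H)
    (hfc : ContinuousOn (Function.uncurry f) (Set.Icc (0 : ℝ) T ×ˢ (Set.univ : Set H)))
    (hfL : LipschitzInSecond T K f)
    (φ g φe ge : H) (hφ : ‖φe - φ‖ ≤ ε) (hg : ‖ge - g‖ ≤ ε)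
    (v : ℝ → H) (hvc : ContinuousOn v (Set.Icc 0 T)) (hv : SolvesReg T ε lam b f φ g v)
    (ue : ℝ → H) (huec : ContinuousOn ue (Set.Icc 0 T))
    (hue : SolvesReg T ε lam b f φe ge ue) :
    ∀ t ∈ Set.Icc (0 : ℝ) T,
      (Real.exp (-(a * t)) * ‖ue t - v t‖) ^ 2
        ≤ 3 * (1 + 1 / lam1) * ε ^ 2 * Real.exp (3 * T * K ^ 2 / lam1 * t) := by
  -- extensions
  have ext : ∀ w : ℝ → H, ContinuousOn w (Set.Icc 0 T) →
      Continuous (fun s => w (Set.projIcc 0 T hT.le s)) := fun w hw =>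
    (continuousOn_iff_continuous_domRestrict.1 hw).comp continuous_projIcc
  have cF : ∀ w : ℝ → H, ContinuousOn w (Set.Icc 0 T) →
      ContinuousOn (fun s => f s (w s)) (Set.Icc 0 T) := fun w hw =>
    hfc.comp (continuousOn_id.prodMk hw) (fun s hs => ⟨hs, Set.mem_univ _⟩)
  have pr : ∀ s ∈ Set.Icc 0 T, ((Set.projIcc 0 T hT.le s : Set.Icc 0 T) : ℝ) = s := fun s hs => by
    rw [Set.projIcc_of_mem hT.le hs]
  set π : ℝ → ℝ := fun s => (Set.projIcc 0 T hT.le s : Set.Icc 0 T) with hπ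
  have rew : ∀ (w : ℝ → H) (φ g : H), SolvesReg T ε lam b f φ g w → ∀ t ∈ Set.Icc 0 T,
      w t = ∑' p, regCoef T ε lam b φ g (fun s => f (π s) (w (π s))) t p • b p := by
    intro w φ g hw t ht
    rw [hw t ht]
    congr 1; ext p
    unfold regCoef
    congr 2
    apply intervalIntegral.integral_congr
    intro s hs
    rw [Set.uIcc_of_le ht.1] at hs
    simp only [hπ, pr s ⟨hs.1, hs.2.trans ht.2⟩]
  have hGu : Continuous (fun s => f (π s) (ue (π s))) := ext _ (cF ue huec)
  have hGv : Continuous (fun s => f (π s) (v (π s))) := ext _ (cF v hvc)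
  have hGd : Continuous (fun s => f (π s) (ue (π s)) - f (π s) (v (π s))) := hGu.sub hGv
  have hyc : Continuous fun s => (Real.exp (-(a * s)) * ‖ue (π s) - v (π s)‖) ^ 2 := by
    have h1 : Continuous (fun s => ue (π s) - v (π s)) := (ext ue huec).sub (ext v hvc)
    have h2 := h1.norm
    exact ((by fun_prop : Continuous fun s => Real.exp (-(a * s))).mul h2).pow 2
  have G := aux_gronwall hyc (A := 3 * (1 + 1 / lam1) * ε ^ 2) (B := 3 * T * K ^ 2 / lam1) (T := T)
    (by positivity) (by positivity) (fun _ => sq_nonneg _) ?_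
  · intro t ht
    have := G t ht
    simpa only [hπ, pr t ht] using this
  intro t ht
  have hπt : π t = t := pr t ht
  have hdiff : ue t - v t = ∑' p, regCoef T ε lam b (φe - φ) (ge - g)
      (fun s => f (π s) (ue (π s)) - f (π s) (v (π s))) t p • b p := by
    rw [rew ue φe ge hue t ht, rew v φ g hv t ht, ← Summable.tsum_sub
      (aux_summable b (regCoef_bound b ha hε hlam1 hlam _ _ hGu ht))
      (aux_summable b (regCoef_bound b ha hε hlam1 hlam _ _ hGv ht))]
    congr 1; ext p
    rw [← sub_smul, regCoef_sub b _ _ _ _ hGu hGv]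
  have hn := aux_norm b (regCoef_bound b ha hε hlam1 hlam (φe - φ) (ge - g) hGd ht)
  rw [← hdiff] at hn
  have hI : (∫ s in (0:ℝ)..t, (Real.exp (-(a * s)) *
        ‖f (π s) (ue (π s)) - f (π s) (v (π s))‖) ^ 2) ≤
      K ^ 2 * ∫ s in (0:ℝ)..t, (Real.exp (-(a * s)) * ‖ue (π s) - v (π s)‖) ^ 2 := by
    rw [← intervalIntegral.integral_const_mul]
    refine intervalIntegral.integral_mono_on ht.1 (Continuous.intervalIntegrable ?_ _ _)
        (Continuous.intervalIntegrable (hyc.const_mul _) _ _) ?_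
    · exact ((by fun_prop : Continuous fun s => Real.exp (-(a * s))).mul hGd.norm).pow 2
    intro s hs
    have hL := hfL (π s) (Set.projIcc 0 T hT.le s).2 (ue (π s)) (v (π s))
    have := pow_le_pow_left₀ (norm_nonneg _) hL 2
    rw [mul_pow, mul_pow]
    rw [mul_pow] at this
    nlinarith [mul_le_mul_of_nonneg_left this (sq_nonneg (Real.exp (-(a * s))))]
  have e1 : Real.exp (-(a * t)) * Real.exp (a * t) = 1 := by
    rw [← Real.exp_add]; simp
  simp only [hπt]
  have hφ2 := pow_le_pow_left₀ (norm_nonneg _) hφ 2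
  have hg2 := pow_le_pow_left₀ (norm_nonneg _) hg 2
  set J := ∫ s in (0:ℝ)..t, (Real.exp (-(a * s)) * ‖ue (π s) - v (π s)‖) ^ 2
  calc (Real.exp (-(a * t)) * ‖ue t - v t‖) ^ 2
      = Real.exp (-(a * t)) ^ 2 * ‖ue t - v t‖ ^ 2 := mul_pow _ _ _
    _ ≤ Real.exp (-(a * t)) ^ 2 * (3 * Real.exp (a * t) ^ 2 * (ε ^ 2 + ε ^ 2 / lam1
        + T / lam1 * (K ^ 2 * J))) := by
      refine mul_le_mul_of_nonneg_left (hn.trans ?_) (sq_nonneg _)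
      gcongr
    _ = (Real.exp (-(a * t)) * Real.exp (a * t)) ^ 2 * (3 * (ε ^ 2 + ε ^ 2 / lam1
        + T / lam1 * (K ^ 2 * J))) := by ring
    _ = _ := by rw [e1]; ring

theorem stmt_6 {H : Type*} [NormedAddCommGroup H] [InnerProductSpace ℝ H] [CompleteSpace H]
    (T K ε : ℝ) (hT : 0 < T) (hε0 : 0 < ε) (hε1 : ε ≤ 1)
    (lam : ℕ → ℝ) (lam1 : ℝ) (hlam1 : 0 < lam1) (hlam : ∀ p, lam1 ≤ lam p)
    (b : HilbertBasis ℕ ℝ H) (f : ℝ → H → H)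
    (hfc : ContinuousOn (Function.uncurry f) (Set.Icc (0 : ℝ) T ×ˢ (Set.univ : Set H)))
    (hfL : LipschitzInSecond T K f)
    (φ g φe ge : H) (hφ : ‖φe - φ‖ ≤ ε) (hg : ‖ge - g‖ ≤ ε)
    (v : ℝ → H) (hvc : ContinuousOn v (Set.Icc 0 T)) (hv : SolvesReg T ε lam b f φ g v)
    (ue : ℝ → H) (huec : ContinuousOn ue (Set.Icc 0 T))
    (hue : SolvesReg T ε lam b f φe ge ue) :
    ∀ t ∈ Set.Icc (0 : ℝ) T,
      ‖ue t - v t‖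
        ≤ Real.sqrt (3 * (1 + 1 / lam1)) * Real.exp (3 * T * K ^ 2 * t / (2 * lam1))
          * ε ^ (1 - t / T) := by
  intro t ht
  obtain ⟨a, ha⟩ : ∃ a, a = -Real.log ε / T := ⟨_, rfl⟩
  have ha0 : 0 ≤ a := by
    rw [ha]; exact div_nonneg (neg_nonneg.2 (Real.log_nonpos hε0.le hε1)) hT.le
  have haT : a * T = -Real.log ε := by rw [ha]; field_simp
  have hε : ε = Real.exp (-(a * T)) := by rw [haT, neg_neg, Real.exp_log hε0]
  have h := aux_main hT ha0 hε lam hlam1 hlam b f hfc hfL φ g φe ge hφ hg v hvc hv ue huec hue t ht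
  have hpow : ε ^ (1 - t / T) = ε * Real.exp (a * t) := by
    rw [Real.rpow_sub hε0, Real.rpow_one, Real.rpow_def_of_pos hε0, div_eq_mul_inv, ← Real.exp_neg]
    congr 2
    rw [ha]; ring
  rw [hpow]
  set w := ‖ue t - v t‖
  have h2 : (Real.sqrt (3 * (1 + 1 / lam1)) * Real.exp (3 * T * K ^ 2 * t / (2 * lam1)) * ε) ^ 2
      = 3 * (1 + 1 / lam1) * ε ^ 2 * Real.exp (3 * T * K ^ 2 / lam1 * t) := by
    rw [mul_pow, mul_pow, Real.sq_sqrt (by positivity), ← Real.exp_nat_mul]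
    have : ((2:ℕ):ℝ) * (3 * T * K ^ 2 * t / (2 * lam1)) = 3 * T * K ^ 2 / lam1 * t := by
      push_cast; field_simp
    rw [this]; ring
  rw [← h2] at h
  have h3 := (abs_le_of_sq_le_sq' h (by positivity)).2
  have e1 : Real.exp (a * t) * Real.exp (-(a * t)) = 1 := by
    rw [← Real.exp_add]; simp
  calc w = Real.exp (a * t) * (Real.exp (-(a * t)) * w) := by rw [← mul_assoc, e1, one_mul]
    _ ≤ Real.exp (a * t) * (Real.sqrt (3 * (1 + 1 / lam1)) *
        Real.exp (3 * T * K ^ 2 * t / (2 * lam1)) * ε) :=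
      mul_le_mul_of_nonneg_left h3 (Real.exp_pos _).le
    _ = _ := by ring
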